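/- arXiv:1205.1851 — 4 statements merged into one kernel-verified Lean document; each statement's English description precedes it below -/
import Mathlib

section
/- Let x ∈ X^n and let α be a partition of Fin n. Then infDist(x, Δ_α) ≤ max d(x_i, x_j), where the maximum ranges over all pairs (i, j) with i ∼_α j. (This is the right-hand half of the paper's key inequality for the sup metric and diagonal sets.) -/
open scoped Classical

/-- The right-hand half of the key inequality: for `x ∈ Xⁿ` (with the sup metric) and a
partition `α` of `Fin n`, the distance from `x` to the diagonal
`Δ_α = {y | y i = y j whenever i ∼_α j}` is at most the maximum of `dist (x i) (x j)` over
pairs `(i, j)` with `i ∼_α j`. -/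
theorem infDist_diagonal_le_sup_dist {X : Type*} [MetricSpace X] {n : ℕ} (hn : 0 < n)
    (α : Setoid (Fin n)) (x : Fin n → X) :
    Metric.infDist x {y : Fin n → X | ∀ i j, α i j → y i = y j} ≤
      (Finset.univ.filter fun p : Fin n × Fin n => α p.1 p.2).sup'
        ⟨(⟨0, hn⟩, ⟨0, hn⟩), Finset.mem_filter.mpr ⟨Finset.mem_univ _, α.refl' _⟩⟩
        (fun p => dist (x p.1) (x p.2)) := by
  let rep : Fin n → Fin n := fun i => (Quotient.mk α i).out
  have hrep : ∀ i, α i (rep i) := fun i => α.symm' (Quotient.mk_out i)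
  have hmem : (fun i => x (rep i)) ∈ {y : Fin n → X | ∀ i j, α i j → y i = y j} :=
    fun i j hij => congrArg (fun q : Quotient α => x q.out) (Quotient.sound hij)
  have hle : ∀ i j, α i j → dist (x i) (x j) ≤
      (Finset.univ.filter fun p : Fin n × Fin n => α p.1 p.2).sup'
        ⟨(⟨0, hn⟩, ⟨0, hn⟩), Finset.mem_filter.mpr ⟨Finset.mem_univ _, α.refl' _⟩⟩
        (fun p => dist (x p.1) (x p.2)) := fun i j hij =>
    Finset.le_sup' (fun p : Fin n × Fin n => dist (x p.1) (x p.2))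
      (Finset.mem_filter.mpr ⟨Finset.mem_univ (i, j), hij⟩)
  refine (Metric.infDist_le_dist_of_mem hmem).trans ?_
  exact (dist_pi_le_iff (dist_nonneg.trans (hle ⟨0, hn⟩ ⟨0, hn⟩ (α.refl' _)))).mpr
    fun i => hle i (rep i) (hrep i)
end

section
/- Let α and γ be partitions of Fin n, let ε₁, ε₂ ≥ 0 be real numbers, and let x ∈ X^n satisfy infDist(x, Δ_α) ≤ ε₁ and infDist(x, Δ_γ) ≤ ε₂. Then infDist(x, Δ_{α⊔γ}) ≤ 2n(ε₁ + ε₂). -/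
open Metric in
/-- Coordinates of `x` in a common block of `α` differ by at most twice the distance from `x`
to the diagonal of `α`. -/
theorem dist_le_two_mul_of_infDist_diagonal_le {ι X : Type*} [Fintype ι] [PseudoMetricSpace X]
    (α : Setoid ι) {ε : ℝ} (x : ι → X)
    (h : infDist x {y : ι → X | ∀ i j, α i j → y i = y j} ≤ ε) {i j : ι} (hij : α i j) :
    dist (x i) (x j) ≤ 2 * ε := by
  have hne : {y : ι → X | ∀ i j, α i j → y i = y j}.Nonempty := ⟨fun _ => x i, fun _ _ _ => rfl⟩
  refine le_of_forall_pos_le_add fun δ hδ => ?_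
  obtain ⟨y, hy, hxy⟩ := (infDist_lt_iff hne).1 (h.trans_lt (lt_add_of_pos_right ε (half_pos hδ)))
  have hi := dist_le_pi_dist x y i
  have hj := dist_le_pi_dist x y j
  have htri := dist_triangle_right (x i) (x j) (y i)
  rw [← hy i j hij] at hj
  linarith

/-- A function moving by at most `c` along each edge of a graph moves by at most
`p.length * c` along a walk `p`. -/
theorem dist_le_walk_length_mul {V X : Type*} [PseudoMetricSpace X]
    {G : SimpleGraph V} {x : V → X} {c : ℝ} (h : ∀ u v, G.Adj u v → dist (x u) (x v) ≤ c)
    {u v : V} (p : G.Walk u v) : dist (x u) (x v) ≤ p.length * c := by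
  induction p with
  | nil => simp
  | @cons u v w huv p ih =>
    have htri := dist_triangle (x u) (x v) (x w)
    have huv' := h u v huv
    rw [SimpleGraph.Walk.length_cons]
    push_cast
    linarith

/-- The join of two equivalence relations is contained in the reachability relation of the graph
whose edges join distinct related points. -/
theorem Setoid.sup_le_reachableSetoid_fromRel {V : Type*} (α γ : Setoid V) :
    α ⊔ γ ≤ (SimpleGraph.fromRel fun i j => α i j ∨ γ i j).reachableSetoid := by
  have key : ∀ i j, α i j ∨ γ i j →
      (SimpleGraph.fromRel fun i j => α i j ∨ γ i j).Reachable i j := by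
    intro i j h
    obtain rfl | hne := eq_or_ne i j
    · exact .refl i
    · exact SimpleGraph.Adj.reachable ((SimpleGraph.fromRel_adj _ _ _).2 ⟨hne, .inl h⟩)
  exact sup_le (fun {i j} h => key i j (.inl h)) (fun {i j} h => key i j (.inr h))

/-- A function moving by at most `c` within blocks of `α` and of `γ` moves by at most
`Fintype.card V * c` within blocks of `α ⊔ γ`. -/
theorem dist_le_card_mul_of_setoid_sup {V X : Type*} [Fintype V] [PseudoMetricSpace X]
    (α γ : Setoid V) {x : V → X} {c : ℝ} (hc : 0 ≤ c)
    (h : ∀ i j, α i j ∨ γ i j → dist (x i) (x j) ≤ c) {i j : V} (hij : (α ⊔ γ) i j) :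
    dist (x i) (x j) ≤ Fintype.card V * c := by
  obtain ⟨p, hp⟩ := SimpleGraph.Reachable.exists_isPath
    (Setoid.sup_le_reachableSetoid_fromRel α γ hij)
  refine (dist_le_walk_length_mul (x := x) (c := c) (fun u v huv => ?_) p).trans
    (mul_le_mul_of_nonneg_right (Nat.cast_le.2 hp.length_lt.le) hc)
  rcases ((SimpleGraph.fromRel_adj _ _ _).1 huv).2 with huv | hvu
  · exact h u v huv
  · exact dist_comm (x u) (x v) ▸ h v u hvu

/-- If `x ∈ Xⁿ` (with the sup metric) is within `ε₁` of the diagonal `Δ_α` and within `ε₂`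
of the diagonal `Δ_γ`, then it is within `2n(ε₁ + ε₂)` of the diagonal `Δ_{α ⊔ γ}` of the
join of the two partitions. -/
theorem infDist_diagonal_sup_le {X : Type*} [MetricSpace X] {n : ℕ} (hn : 0 < n)
    (α γ : Setoid (Fin n)) {ε₁ ε₂ : ℝ} (hε₁ : 0 ≤ ε₁) (hε₂ : 0 ≤ ε₂) (x : Fin n → X)
    (h₁ : Metric.infDist x {y : Fin n → X | ∀ i j, α i j → y i = y j} ≤ ε₁)
    (h₂ : Metric.infDist x {y : Fin n → X | ∀ i j, γ i j → y i = y j} ≤ ε₂) :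
    Metric.infDist x {y : Fin n → X | ∀ i j, (α ⊔ γ) i j → y i = y j} ≤
      2 * n * (ε₁ + ε₂) := by
  have hc : ∀ i j, α i j ∨ γ i j → dist (x i) (x j) ≤ 2 * (ε₁ + ε₂) := by
    rintro i j (h | h)
    · linarith [dist_le_two_mul_of_infDist_diagonal_le α x h₁ h]
    · linarith [dist_le_two_mul_of_infDist_diagonal_le γ x h₂ h]
  let y : Fin n → X := fun i => x (Quotient.mk (α ⊔ γ) i).out
  have hy : y ∈ {y : Fin n → X | ∀ i j, (α ⊔ γ) i j → y i = y j} := fun i j hij =>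
    congrArg (fun q : Quotient (α ⊔ γ) => x q.out) (Quotient.sound hij)
  refine (Metric.infDist_le_dist_of_mem hy).trans
    ((dist_pi_le_iff (by positivity)).2 fun i => ?_)
  have hi := dist_le_card_mul_of_setoid_sup α γ (by positivity) hc
    ((α ⊔ γ).symm (Quotient.mk_out (s := α ⊔ γ) i))
  rw [Fintype.card_fin] at hi
  linarith
end

section
/- Let τ := min over all partitions γ of Fin n of ε(γ). Let α < β be partitions of Fin n and let x ∈ V_{α,β}. Then infDist(x, Δ_{αβ}) ≥ τ, where Δ_{αβ} := {y ∈ X^n | there exist i, j ∈ Fin n with i ∼_β j, not i ∼_α j, and y_i = y_j}. -/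
/-- The diagonal `Δ_α ⊆ Xⁿ` associated to a partition (equivalence relation) `α` of `Fin n`. -/
def diagSet {X : Type*} {n : ℕ} (α : Setoid (Fin n)) : Set (Fin n → X) :=
  {y | ∀ i j, α i j → y i = y j}

/-- The open `ε(α)`-neighbourhood `U_α` of the diagonal `Δ_α` in `Xⁿ` (sup metric). -/
def Uset {X : Type*} [MetricSpace X] {n : ℕ} (ε : Setoid (Fin n) → ℝ)
    (α : Setoid (Fin n)) : Set (Fin n → X) :=
  {x | Metric.infDist x (diagSet α) < ε α}

/-- The set `V_{α,β} = (Xⁿ ∖ U_β) ∖ ⋃_{γ < β, γ ≰ α} closure (U_γ)`. -/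
def Vset {X : Type*} [MetricSpace X] {n : ℕ} (ε : Setoid (Fin n) → ℝ)
    (α β : Setoid (Fin n)) : Set (Fin n → X) :=
  (Uset ε β)ᶜ \ ⋃ γ ∈ {γ : Setoid (Fin n) | γ < β ∧ ¬γ ≤ α}, closure (Uset ε γ)

theorem mem_Uset_ker_inf_of_dist_lt {X : Type*} [MetricSpace X] {n : ℕ}
    {ε : Setoid (Fin n) → ℝ} (β : Setoid (Fin n)) {x y : Fin n → X}
    (h : dist x y < ε (Setoid.ker y ⊓ β)) : x ∈ Uset ε (Setoid.ker y ⊓ β) :=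
  (Metric.infDist_le_dist_of_mem
    (show y ∈ diagSet (Setoid.ker y ⊓ β) from fun _ _ hij => hij.1)).trans_lt h

/-- Let `τ` be the minimum of `ε` over all partitions of `Fin n` (the set of partitions is
finite, so the infimum `⨅ γ, ε γ` is this minimum). If `α < β` and `x ∈ V_{α,β}`, then the
distance from `x` to `Δ_{αβ} = {y | ∃ i j, i ∼_β j, ¬(i ∼_α j), y i = y j}` is at least `τ`. -/
theorem infDist_partial_diagonal_ge_of_mem_Vset {X : Type*} [MetricSpace X] {n : ℕ}
    (hn : 0 < n) (ε : Setoid (Fin n) → ℝ) (hε : ∀ α, 0 < ε α)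
    (α β : Setoid (Fin n)) (hαβ : α < β) (x : Fin n → X) (hx : x ∈ Vset ε α β) :
    Metric.infDist x {y : Fin n → X | ∃ i j, β i j ∧ ¬α i j ∧ y i = y j} ≥
      ⨅ γ : Setoid (Fin n), ε γ := by
  by_contra! hlt
  obtain ⟨i, j, hβ, hα⟩ : ∃ i j, β i j ∧ ¬α i j := by
    by_contra! h
    exact hαβ.not_ge fun {i j} => h i j
  have hne : {y : Fin n → X | ∃ i j, β i j ∧ ¬α i j ∧ y i = y j}.Nonempty :=
    ⟨fun _ => x i, i, j, hβ, hα, rfl⟩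
  obtain ⟨y, ⟨k, l, hkl, hkl', hy⟩, hxy⟩ := (Metric.infDist_lt_iff hne).1 hlt
  have hbdd : BddBelow (Set.range ε) := ⟨0, by rintro _ ⟨γ, rfl⟩; exact (hε γ).le⟩
  have hU : x ∈ Uset ε (Setoid.ker y ⊓ β) :=
    mem_Uset_ker_inf_of_dist_lt β (hxy.trans_le (ciInf_le hbdd _))
  rcases (inf_le_right : Setoid.ker y ⊓ β ≤ β).eq_or_lt with heq | hγ
  · exact hx.1 (heq ▸ hU)
  · exact hx.2 (Set.mem_biUnion
      (show Setoid.ker y ⊓ β < β ∧ ¬Setoid.ker y ⊓ β ≤ α from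
        ⟨hγ, fun h => hkl' (h ⟨hy, hkl⟩)⟩) (subset_closure hU))
end

section
/- Let M be an additive commutative group, let μ₀ be a partition of Fin n, and let C, D be functions from the set of partitions of Fin n to M such that for every partition α with μ₀ ≤ α one has C(α) = Σ_{γ, μ₀ ≤ γ ≤ α} D(γ), the sum being over all partitions γ in the (finite) interval [μ₀, α]. Then D(⊤) = Σ_{α, μ₀ ≤ α} (−1)^{c(α)−1} · (c(α)−1)! · C(α), where the sum is over all partitions α with μ₀ ≤ α, and c(α) denotes the number of equivalence classes of α. (Equivalently: if D is defined inductively on [μ₀, ⊤] by D(μ₀) = C(μ₀) and D(α) = C(α) − Σ_{γ ∈ [μ₀, α)} D(γ), then D(⊤) is the stated alternating sum.) -/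
open scoped Classical

/-- The type of partitions (equivalence relations) of `Fin n` is finite. -/
noncomputable instance setoidFinFintype (n : ℕ) : Fintype (Setoid (Fin n)) :=
  Fintype.ofInjective (fun s : Setoid (Fin n) => s.r)
    (fun a b h => Setoid.ext fun x y => by rw [show a.r = b.r from h])

open Polynomial in
/-- The linear coefficient of `X (X - 1) ⋯ (X - k)` is `(-1)^k k!`. -/
lemma descPochhammer_succ_coeff_one (k : ℕ) :
    (descPochhammer ℤ (k + 1)).coeff 1 = (-1) ^ k * (k.factorial : ℤ) := by
  have heval : (descPochhammer ℤ k).eval (-1) = (-1) ^ k * (k.factorial : ℤ) := by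
    induction k with
    | zero => simp
    | succ k ih =>
      rw [descPochhammer_succ_eval, ih, Nat.factorial_succ]
      push_cast
      ring
  rw [descPochhammer_succ_left, coeff_X_mul, coeff_zero_eq_eval_zero, eval_comp]
  simpa using heval

/-- Functions with kernel `α` correspond to embeddings of the quotient by `α`. -/
def Setoid.kerEqEquivEmbedding {ι κ : Type*} (α : Setoid ι) :
    {f : ι → κ // Setoid.ker f = α} ≃ (Quotient α ↪ κ) where
  toFun f := ⟨Quotient.lift f.1 fun a b hab => by
      have h : (Setoid.ker f.1) a b := by rw [f.2]; exact hab
      exact h, by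
    rintro ⟨a⟩ ⟨b⟩ hab
    refine Quotient.sound ?_
    have h : (Setoid.ker f.1) a b := hab
    rw [f.2] at h
    exact h⟩
  invFun g := ⟨fun a => g ⟦a⟧, by
    ext a b
    rw [Setoid.ker_def, g.injective.eq_iff]
    exact Quotient.eq⟩
  left_inv _ := rfl
  right_inv g := by
    ext ⟨a⟩
    rfl

/-- Counting functions that are constant on the blocks of `γ` according to their kernel. -/
lemma pow_card_quotient_eq_sum_descFactorial {ι : Type*} [Fintype ι] [Fintype (Setoid ι)]
    (γ : Setoid ι) (m : ℕ) :
    m ^ Fintype.card (Quotient γ) =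
      ∑ α ∈ Finset.univ.filter fun α : Setoid ι => γ ≤ α,
        m.descFactorial (Fintype.card (Quotient α)) := by
  have hcard : m ^ Fintype.card (Quotient γ) =
      (Finset.univ.filter fun f : ι → Fin m => γ ≤ Setoid.ker f).card := by
    rw [← Fintype.card_subtype, Fintype.card_congr (Setoid.liftEquiv γ), Fintype.card_fun,
      Fintype.card_fin]
  rw [hcard, Finset.card_eq_sum_card_fiberwise (f := fun f : ι → Fin m => Setoid.ker f)
    (t := Finset.univ.filter fun α : Setoid ι => γ ≤ α) (fun f hf => by simpa using hf)]
  refine Finset.sum_congr rfl fun α hα => ?_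
  have hfiber : ((Finset.univ.filter fun f : ι → Fin m => γ ≤ Setoid.ker f).filter
      fun f => Setoid.ker f = α) = Finset.univ.filter fun f : ι → Fin m => Setoid.ker f = α := by
    ext f
    simp only [Finset.mem_filter, Finset.mem_univ, true_and] at hα ⊢
    exact ⟨fun h => h.2, fun h => ⟨h ▸ hα, h⟩⟩
  rw [hfiber, ← Fintype.card_subtype, Fintype.card_congr (Setoid.kerEqEquivEmbedding α),
    Fintype.card_embedding_eq, Fintype.card_fin]

open Polynomial in
/-- Expansion of a power of `X` in falling factorials, indexed by the partitions coarser
than `γ`. -/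
lemma X_pow_card_quotient_eq_sum_descPochhammer {ι : Type*} [Fintype ι] [Fintype (Setoid ι)]
    (γ : Setoid ι) :
    (X : ℤ[X]) ^ Fintype.card (Quotient γ) =
      ∑ α ∈ Finset.univ.filter fun α : Setoid ι => γ ≤ α,
        descPochhammer ℤ (Fintype.card (Quotient α)) := by
  refine eq_of_infinite_eval_eq _ _
    ((Set.infinite_range_of_injective (Nat.cast_injective (R := ℤ))).mono ?_)
  rintro _ ⟨m, rfl⟩
  simp only [Set.mem_ofPred_eq, eval_pow, eval_X, eval_finsetSum,
    descPochhammer_eval_eq_descFactorial]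
  exact_mod_cast pow_card_quotient_eq_sum_descFactorial γ m

/-- The Möbius function of the partition lattice: the alternating sum over the partitions
coarser than `γ` vanishes unless `γ = ⊤`. -/
lemma sum_neg_one_pow_mul_factorial_card_quotient {ι : Type*} [Fintype ι] [Nonempty ι]
    [Fintype (Setoid ι)] (γ : Setoid ι) :
    ∑ α ∈ Finset.univ.filter fun α : Setoid ι => γ ≤ α,
      ((-1 : ℤ) ^ (Fintype.card (Quotient α) - 1) *
        (Nat.factorial (Fintype.card (Quotient α) - 1) : ℤ)) = if γ = ⊤ then 1 else 0 := by
  have hpos (α : Setoid ι) : 0 < Fintype.card (Quotient α) :=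
    Fintype.card_pos_iff.mpr (Nonempty.map (Quotient.mk α) inferInstance)
  have htop : 1 = Fintype.card (Quotient γ) ↔ γ = ⊤ := by
    rw [← Quotient.subsingleton_iff, ← Fintype.card_le_one_iff_subsingleton]
    have := hpos γ
    omega
  have hcoeff := congrArg (Polynomial.coeff · 1) (X_pow_card_quotient_eq_sum_descPochhammer γ)
  simp only [Polynomial.coeff_X_pow, Polynomial.finsetSum_coeff, htop] at hcoeff
  rw [hcoeff]
  refine Finset.sum_congr rfl fun α _ => ?_
  rw [← descPochhammer_succ_coeff_one, Nat.sub_add_cancel (hpos α)]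

/-- Möbius inversion on the lattice of partitions of `Fin n`: if
`C(α) = Σ_{μ₀ ≤ γ ≤ α} D(γ)` for every `α ≥ μ₀`, then
`D(⊤) = Σ_{μ₀ ≤ α} (-1)^(c(α)-1) (c(α)-1)! C(α)`, where `c(α)` is the number of
equivalence classes (blocks) of `α` and `⊤` is the one-block partition. -/
theorem D_top_eq_alternating_sum {n : ℕ} (hn : 0 < n) {M : Type*} [AddCommGroup M]
    (μ₀ : Setoid (Fin n)) (C D : Setoid (Fin n) → M)
    (h : ∀ α : Setoid (Fin n), μ₀ ≤ α →
      C α = ∑ γ ∈ Finset.univ.filter fun γ : Setoid (Fin n) => μ₀ ≤ γ ∧ γ ≤ α, D γ) :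
    D ⊤ = ∑ α ∈ Finset.univ.filter fun α : Setoid (Fin n) => μ₀ ≤ α,
      ((-1 : ℤ) ^ (Fintype.card (Quotient α) - 1) *
        (Nat.factorial (Fintype.card (Quotient α) - 1) : ℤ)) • C α := by
  have : Nonempty (Fin n) := ⟨⟨0, hn⟩⟩
  have hexpand : ∀ α ∈ Finset.univ.filter fun α : Setoid (Fin n) => μ₀ ≤ α,
      ((-1 : ℤ) ^ (Fintype.card (Quotient α) - 1) *
        (Nat.factorial (Fintype.card (Quotient α) - 1) : ℤ)) • C α =
      ∑ γ ∈ Finset.univ.filter fun γ : Setoid (Fin n) => μ₀ ≤ γ ∧ γ ≤ α,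
        ((-1 : ℤ) ^ (Fintype.card (Quotient α) - 1) *
          (Nat.factorial (Fintype.card (Quotient α) - 1) : ℤ)) • D γ := fun α hα => by
    rw [h α (Finset.mem_filter.mp hα).2, Finset.smul_sum]
  rw [Finset.sum_congr rfl hexpand, Finset.sum_comm'
    (t' := Finset.univ.filter fun γ : Setoid (Fin n) => μ₀ ≤ γ)
    (s' := fun γ => Finset.univ.filter fun α : Setoid (Fin n) => γ ≤ α)]
  · simp_rw [← Finset.sum_smul, sum_neg_one_pow_mul_factorial_card_quotient]
    simp
  · intro α γ
    simp only [Finset.mem_filter, Finset.mem_univ, true_and]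
    exact ⟨fun h => ⟨h.2.2, h.2.1⟩, fun h => ⟨h.2.trans h.1, h.2, h.1⟩⟩
end
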